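/- Let T = (T_1, …, T_N) with X := T_1. Let μ = P + V_0(T) + Σ_{i≥1} V_i(T) P^{−i} be a Laurent series in P^{−1} with smooth coefficients and M := Σ_{n=1}^{N} n T_n μ^{n−1} + Σ_{i≥1} S_i(T) μ^{−i} with smooth S_i. Let f(P,X), g(P,X) be Laurent polynomials in P with coefficients polynomial in X satisfying {f, g} = 1, and suppose f(μ, M)_{≤0} = 0 and g(μ, M)_{≤−1} = 0, where f(μ,M) denotes the substitution P ↦ μ, X ↦ M. Then the canonical Poisson relation {μ, M} = 1 holds. -/

import Mathlib

namespace DMKP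

/-- Coefficient functions of a formal Laurent series in `P⁻¹` with time variables
`T = (T₁, …, T_N)`: `A n` is the coefficient of `P^n`. -/
abbrev Coeffs (N : ℕ) := ℤ → (Fin N → ℝ) → ℝ

variable {N : ℕ}

/-- Partial derivative in the direction of the `q`-th time variable. -/
noncomputable def pd (q : Fin N) (f : (Fin N → ℝ) → ℝ) : (Fin N → ℝ) → ℝ :=
  fun x => fderiv ℝ f x (Pi.single q 1)

/-- Finitely many positive powers of `P`. -/
def BddPow (A : Coeffs N) : Prop := ∃ m : ℤ, ∀ n : ℤ, m < n → A n = 0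

/-- All coefficients are smooth functions of the time variables. -/
def SmoothCoeffs (A : Coeffs N) : Prop := ∀ n : ℤ, ContDiff ℝ (⊤ : ℕ∞) (A n)

/-- A Laurent series in `P⁻¹` with smooth coefficients. -/
def IsLaurent (A : Coeffs N) : Prop := BddPow A ∧ SmoothCoeffs A

/-- Termwise `∂_P`. -/
def dP (A : Coeffs N) : Coeffs N := fun n x => ((n + 1 : ℤ) : ℝ) * A (n + 1) x

/-- Termwise `∂_{T_q}`. -/
noncomputable def dT (q : Fin N) (A : Coeffs N) : Coeffs N := fun n => pd q (A n)

/-- Termwise `∂_X`, where `X = T₁`. -/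
noncomputable def dX [NeZero N] (A : Coeffs N) : Coeffs N := dT 0 A

/-- Termwise product of Laurent series. -/
noncomputable def mul (A B : Coeffs N) : Coeffs N := fun n x => ∑' i : ℤ, A i x * B (n - i) x

/-- The Poisson bracket `{f,g} = f_P g_X - f_X g_P`. -/
noncomputable def pb [NeZero N] (A B : Coeffs N) : Coeffs N :=
  fun n x => mul (dP A) (dX B) n x - mul (dX A) (dP B) n x

/-- Truncation keeping only powers `P^n` with `n ≥ k`. -/
def truncGe (k : ℤ) (A : Coeffs N) : Coeffs N := fun n => if k ≤ n then A n else 0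

/-- Truncation keeping only powers `P^n` with `n ≤ k`. -/
def truncLe (k : ℤ) (A : Coeffs N) : Coeffs N := fun n => if n ≤ k then A n else 0

/-- The residue: coefficient of `P⁻¹`. -/
def res (A : Coeffs N) : (Fin N → ℝ) → ℝ := A (-1)

/-- The constant Laurent series `1`. -/
def one' : Coeffs N := fun n => if n = 0 then (fun _ => (1 : ℝ)) else 0

/-- `powC A q` is the `q`-th power `A^q`. -/
noncomputable def powC (A : Coeffs N) : ℕ → Coeffs N
  | 0 => one'
  | q + 1 => mul A (powC A q)

/-- `e^{-ad φ} A = Σ_{k≥0} (1/k!) (φ_X)^k ∂_P^k A`. -/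
noncomputable def expAdNeg [NeZero N] (φ : (Fin N → ℝ) → ℝ) (A : Coeffs N) : Coeffs N :=
  fun n x => ∑' k : ℕ, (pd 0 φ x) ^ k / (Nat.factorial k : ℝ) * (dP^[k] A) n x

/-- `e^{ad φ} A = Σ_{k≥0} (1/k!) (-φ_X)^k ∂_P^k A`. -/
noncomputable def expAdPos [NeZero N] (φ : (Fin N → ℝ) → ℝ) (A : Coeffs N) : Coeffs N :=
  fun n x => ∑' k : ℕ, (-(pd 0 φ x)) ^ k / (Nat.factorial k : ℝ) * (dP^[k] A) n x

/-- A `P`-independent function viewed as a Laurent series concentrated at `P^0`. -/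
def const (φ : (Fin N → ℝ) → ℝ) : Coeffs N := fun n => if n = 0 then φ else 0

/-- Evaluation of the polynomial (non-negative) part of `A` at `P = φ_X`. -/
noncomputable def evalAtPhiX [NeZero N] (A : Coeffs N) (φ : (Fin N → ℝ) → ℝ) :
    (Fin N → ℝ) → ℝ :=
  fun x => ∑' k : ℕ, A (k : ℤ) x * (pd 0 φ x) ^ k

/-- The shape `λ = P + U₂ P⁻¹ + U₃ P⁻² + ⋯` of the dKP Lax function. -/
def IsDKPShape (lam : Coeffs N) : Prop :=
  (lam 1 = fun _ => (1 : ℝ)) ∧ lam 0 = 0 ∧ ∀ n : ℤ, 2 ≤ n → lam n = 0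

/-- The shape `μ = P + V₀ + V₁ P⁻¹ + ⋯` of the dmKP Lax function. -/
def IsDMKPShape (mu : Coeffs N) : Prop :=
  (mu 1 = fun _ => (1 : ℝ)) ∧ ∀ n : ℤ, 2 ≤ n → mu n = 0


/-- `μ^j` for `j : ℤ`, given an inverse `μ⁻¹`. -/
noncomputable def zpowPair {N : ℕ} (mu muinv : Coeffs N) (j : ℤ) : Coeffs N :=
  if 0 ≤ j then powC mu j.toNat else powC muinv (-j).toNat

/-- The Orlov function `M = Σ_{n=1}^N n T_n μ^{n-1} + Σ_{i≥1} S_i μ^{-i}` of dmKP. -/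
noncomputable def orlov {N : ℕ} (mu muinv : Coeffs N) (S : ℕ → (Fin N → ℝ) → ℝ) :
    Coeffs N :=
  fun n x => (∑ q : Fin N, (((q : ℕ) + 1 : ℕ) : ℝ) * x q * powC mu (q : ℕ) n x)
    + ∑' i : ℕ, S (i + 1) x * powC muinv (i + 1) n x

/-- A Laurent polynomial `f(P,X) = Σ c_{jk} P^j X^k` (finitely many terms, coefficients
polynomial in `X`) viewed as a Laurent series whose coefficients depend only on `X = T₁`. -/
noncomputable def polyToCoeffs {N : ℕ} [NeZero N] (f : ℤ →₀ Polynomial ℝ) : Coeffs N :=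
  fun n x => (f n).eval (x 0)

/-- Substitution `P ↦ μ`, `X ↦ M` into a Laurent polynomial `f(P,X)`. -/
noncomputable def substC {N : ℕ} (f : ℤ →₀ Polynomial ℝ) (mu muinv M : Coeffs N) :
    Coeffs N :=
  fun n x => ∑ j ∈ f.support, ∑ k ∈ (f j).support,
    (f j).coeff k * mul (zpowPair mu muinv j) (powC M k) n x

section Algebra

/-- Substitution `P ↦ u`, `X ↦ m` into a Laurent polynomial in `P` with coefficients
polynomial in `X`. -/
noncomputable def substHom {A : Type*} [CommRing A] [Algebra ℝ A] (u : Aˣ) (m : A) :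
    LaurentPolynomial (Polynomial ℝ) →+* A :=
  LaurentPolynomial.eval₂ (Polynomial.aeval m : Polynomial ℝ →ₐ[ℝ] A).toRingHom u

theorem substHom_C_mul_T {A : Type*} [CommRing A] [Algebra ℝ A] (u : Aˣ) (m : A)
    (p : Polynomial ℝ) (n : ℤ) :
    substHom u m (LaurentPolynomial.C p * LaurentPolynomial.T n) =
      Polynomial.aeval m p * ((u ^ n : Aˣ) : A) := by
  simp [substHom]

theorem derivation_units_zpow {A : Type*} [CommRing A] [Algebra ℝ A] (D : Derivation ℝ A A)
    (u : Aˣ) (n : ℤ) :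
    D ((u ^ n : Aˣ) : A) = (n : A) * ((u ^ (n - 1) : Aˣ) : A) * D (u : A) := by
  have step (k : ℤ) : D ((u ^ (k + 1) : Aˣ) : A) =
      ((u ^ k : Aˣ) : A) * D (u : A) + (u : A) * D ((u ^ k : Aˣ) : A) := by
    rw [zpow_add_one, Units.val_mul, D.leibniz, smul_eq_mul, smul_eq_mul]
  have hmul (k : ℤ) : ((u ^ k : Aˣ) : A) = (u : A) * ((u ^ (k - 1) : Aˣ) : A) := by
    rw [← Units.val_mul, ← zpow_one_add]; congr 2; ring
  induction n using Int.induction_on with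
  | zero => simp
  | succ k ih =>
    rw [step, ih, add_sub_cancel_right, hmul (k : ℤ)]
    push_cast
    ring
  | pred k ih =>
    have h := step (-(k : ℤ) - 1)
    rw [sub_add_cancel, ih] at h
    apply u.isUnit.mul_left_cancel
    push_cast at h ⊢
    linear_combination -h - ((k : A) + 1) * D (u : A) * hmul (-(k : ℤ) - 1)

theorem exists_chain_rule (f : LaurentPolynomial (Polynomial ℝ)) :
    ∃ fP fX : LaurentPolynomial (Polynomial ℝ), ∀ {A : Type} [CommRing A] [Algebra ℝ A]
      (u : Aˣ) (m : A) (D : Derivation ℝ A A),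
      D (substHom u m f) = substHom u m fP * D u + substHom u m fX * D m := by
  induction f using LaurentPolynomial.induction_on' with
  | add p q hp hq =>
    obtain ⟨pP, pX, hp⟩ := hp
    obtain ⟨qP, qX, hq⟩ := hq
    refine ⟨pP + qP, pX + qX, fun u m D => ?_⟩
    simp only [map_add, hp u m D, hq u m D]
    ring
  | C_mul_T n p =>
    refine ⟨.C ((n : Polynomial ℝ) * p) * .T (n - 1), .C (Polynomial.derivative p) * .T n,
      fun u m D => ?_⟩
    rw [substHom_C_mul_T, substHom_C_mul_T, substHom_C_mul_T, D.leibniz, D.map_aeval,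
      derivation_units_zpow]
    simp only [smul_eq_mul, map_mul, map_intCast]
    ring

/-- The Poisson bracket attached to a pair of derivations. -/
def bracket {A : Type*} [CommRing A] [Algebra ℝ A] (D E : Derivation ℝ A A) (a b : A) : A :=
  D a * E b - E a * D b

theorem exists_bracket_substHom (f g : LaurentPolynomial (Polynomial ℝ)) :
    ∃ J : LaurentPolynomial (Polynomial ℝ), ∀ {A : Type} [CommRing A] [Algebra ℝ A]
      (u : Aˣ) (m : A) (D E : Derivation ℝ A A),
      bracket D E (substHom u m f) (substHom u m g) = substHom u m J * bracket D E u m := by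
  obtain ⟨fP, fX, hf⟩ := exists_chain_rule f
  obtain ⟨gP, gX, hg⟩ := exists_chain_rule g
  refine ⟨fP * gX - fX * gP, fun u m D E => ?_⟩
  simp only [bracket, hf u m, hg u m, map_sub, map_mul]
  ring

theorem bracket_add_right {A : Type*} [CommRing A] [Algebra ℝ A] (D E : Derivation ℝ A A)
    (a b c : A) : bracket D E a (b + c) = bracket D E a b + bracket D E a c := by
  simp only [bracket, map_add]
  ring

theorem bracket_sum_right {A ι : Type*} [CommRing A] [Algebra ℝ A] (D E : Derivation ℝ A A)
    (a : A) (s : Finset ι) (b : ι → A) :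
    bracket D E a (∑ i ∈ s, b i) = ∑ i ∈ s, bracket D E a (b i) := by
  simp only [bracket, map_sum, Finset.mul_sum, Finset.sum_sub_distrib]

theorem bracket_of_eq_zero {A : Type*} [CommRing A] [Algebra ℝ A] (D E : Derivation ℝ A A)
    (a : A) {b : A} (hb : D b = 0) : bracket D E a b = D a * E b := by
  rw [bracket, hb, mul_zero, sub_zero]

theorem bracket_mul_pow_self {A : Type*} [CommRing A] [Algebra ℝ A] (D E : Derivation ℝ A A)
    (a c : A) (k : ℕ) : bracket D E a (c * a ^ k) = bracket D E a c * a ^ k := by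
  simp only [bracket, D.leibniz, E.leibniz, D.leibniz_pow, E.leibniz_pow, smul_eq_mul,
    nsmul_eq_mul]
  ring

/-- The coefficientwise algebra structure takes precedence over the one which is induced by
power series. -/
noncomputable instance hahnSeriesAlgebra {R : Type*} [CommRing R] [Algebra ℝ R] :
    Algebra ℝ (HahnSeries ℤ R) :=
  HahnSeries.instAlgebra

/-- The linear map on Hahn series that acts on the coefficients in degree `n` by `d n`. -/
noncomputable def hahnMap {R : Type*} [CommRing R] [Algebra ℝ R] (d : ℤ → R →ₗ[ℝ] R) :
    HahnSeries ℤ R →ₗ[ℝ] HahnSeries ℤ R where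
  toFun a := ⟨fun n => d n (a.coeff n), a.isPWO_support.mono fun n hn h => hn (by simp [h])⟩
  map_add' a b := by ext n; simp
  map_smul' r a := by ext n; simp

theorem coeff_hahnMap {R : Type*} [CommRing R] [Algebra ℝ R] (d : ℤ → R →ₗ[ℝ] R)
    (a : HahnSeries ℤ R) (n : ℤ) : (hahnMap d a).coeff n = d n (a.coeff n) :=
  rfl

theorem support_hahnMap_subset {R : Type*} [CommRing R] [Algebra ℝ R] (d : ℤ → R →ₗ[ℝ] R)
    (a : HahnSeries ℤ R) : (hahnMap d a).support ⊆ a.support :=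
  fun n hn h => hn (by rw [coeff_hahnMap, h, map_zero])

/-- The map `hahnMap d` as a derivation, for a family `d` that obeys a graded Leibniz rule. -/
noncomputable def hahnDerivation {R : Type*} [CommRing R] [Algebra ℝ R] (d : ℤ → R →ₗ[ℝ] R)
    (hd : ∀ i j a b, d (i + j) (a * b) = a * d j b + b * d i a) :
    Derivation ℝ (HahnSeries ℤ R) (HahnSeries ℤ R) :=
  Derivation.mk' (hahnMap d) (by
    intro a b
    ext n
    rw [smul_eq_mul, smul_eq_mul, HahnSeries.coeff_add, mul_comm b,
      HahnSeries.coeff_mul_right' b.isPWO_support (support_hahnMap_subset d b),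
      HahnSeries.coeff_mul_left' a.isPWO_support (support_hahnMap_subset d a), coeff_hahnMap,
      HahnSeries.coeff_mul, map_sum, ← Finset.sum_add_distrib]
    refine Finset.sum_congr rfl fun ij hij => ?_
    rw [Finset.mem_antidiagonal] at hij
    rw [coeff_hahnMap, coeff_hahnMap, ← hij.2.2, hd, mul_comm (b.coeff _)])

@[simp]
theorem coeff_hahnDerivation {R : Type*} [CommRing R] [Algebra ℝ R] (d : ℤ → R →ₗ[ℝ] R)
    (hd : ∀ i j a b, d (i + j) (a * b) = a * d j b + b * d i a) (a : HahnSeries ℤ R) (n : ℤ) :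
    (hahnDerivation d hd a).coeff n = d n (a.coeff n) :=
  rfl

/-- The derivation `∂_P` of Hahn series in the variable `P⁻¹`. -/
noncomputable def hahnDerP (R : Type*) [CommRing R] [Algebra ℝ R] :
    Derivation ℝ (HahnSeries ℤ R) (HahnSeries ℤ R) :=
  HahnSeries.single (1 : ℤ) (1 : R) •
    hahnDerivation (R := R) (fun n => (-(n : ℝ)) • LinearMap.id) (by
      intro i j a b
      simp only [LinearMap.smul_apply, LinearMap.id_apply, mul_smul_comm]
      rw [mul_comm b, ← add_smul]
      congr 1
      push_cast
      ring)

theorem coeff_hahnDerP {R : Type*} [CommRing R] [Algebra ℝ R] (a : HahnSeries ℤ R) (n : ℤ) :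
    (hahnDerP R a).coeff n = (-((n - 1 : ℤ) : ℝ)) • a.coeff (n - 1) := by
  rw [hahnDerP, Derivation.smul_apply, smul_eq_mul, HahnSeries.coeff_single_mul, one_mul,
    coeff_hahnDerivation, LinearMap.smul_apply, LinearMap.id_apply]

theorem hahnSeries_coeff_mul_eq_zero {R : Type*} [CommRing R] {a b : HahnSeries ℤ R} {n : ℤ}
    (h : ∀ i j, i + j = n → a.coeff i = 0 ∨ b.coeff j = 0) : (a * b).coeff n = 0 := by
  rw [HahnSeries.coeff_mul]
  refine Finset.sum_eq_zero fun ij hij => ?_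
  rw [Finset.mem_antidiagonal] at hij
  rcases h _ _ hij.2.2 with h | h <;> simp [h]

end Algebra


section LaurentSeries

/-- The algebra of smooth functions of the time variables. -/
def smoothFun (N : ℕ) : Subalgebra ℝ ((Fin N → ℝ) → ℝ) where
  carrier := {f | ContDiff ℝ (⊤ : ℕ∞) f}
  mul_mem' hf hg := by
    rw [Set.mem_ofPred_eq] at *
    exact hf.mul hg
  add_mem' hf hg := by
    rw [Set.mem_ofPred_eq] at *
    exact hf.add hg
  algebraMap_mem' r := by
    rw [Set.mem_ofPred_eq]
    exact contDiff_const (c := r)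

/-- The ring of smooth functions of the time variables, as a type whose algebraic structure
is sealed off from that of the subalgebra `smoothFun`. -/
def SmoothFun (N : ℕ) : Type :=
  smoothFun N

namespace SmoothFun

noncomputable instance : CommRing (SmoothFun N) :=
  inferInstanceAs (CommRing (smoothFun N))

noncomputable instance : Algebra ℝ (SmoothFun N) :=
  inferInstanceAs (Algebra ℝ (smoothFun N))

/-- A smooth function as an element of the ring of smooth functions. -/
def mk (f : (Fin N → ℝ) → ℝ) (hf : ContDiff ℝ (⊤ : ℕ∞) f) : SmoothFun N :=
  (⟨f, hf⟩ : smoothFun N)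

/-- The function that underlies a smooth function. -/
noncomputable def val : SmoothFun N →ₐ[ℝ] (Fin N → ℝ) → ℝ :=
  (smoothFun N).val

@[simp]
theorem val_mk (f : (Fin N → ℝ) → ℝ) (hf : ContDiff ℝ (⊤ : ℕ∞) f) : val (mk f hf) = f :=
  rfl

theorem val_injective : Function.Injective (val (N := N)) :=
  Subtype.val_injective

theorem contDiff_val (f : SmoothFun N) : ContDiff ℝ (⊤ : ℕ∞) (val f) :=
  Subtype.property (p := (· ∈ smoothFun N)) f

theorem differentiableAt_val (f : SmoothFun N) (x : Fin N → ℝ) :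
    DifferentiableAt ℝ (val f) x :=
  ((contDiff_val f).differentiable (by simp)).differentiableAt

theorem contDiff_pd_val (q : Fin N) (f : SmoothFun N) : ContDiff ℝ (⊤ : ℕ∞) (pd q (val f)) :=
  ((contDiff_val f).fderiv_right (m := (⊤ : ℕ∞)) (by simp)).clm_apply contDiff_const

/-- The partial derivative `pd q` as a linear map on smooth functions. -/
noncomputable def pdLinear (q : Fin N) : SmoothFun N →ₗ[ℝ] SmoothFun N where
  toFun f := mk (pd q (val f)) (contDiff_pd_val q f)
  map_add' f g := by
    apply val_injective
    ext x
    simp [pd, fderiv_add (differentiableAt_val f x) (differentiableAt_val g x)]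
  map_smul' r f := by
    apply val_injective
    ext x
    simp [pd, fderiv_const_smul (differentiableAt_val f x)]

@[simp]
theorem val_pdLinear (q : Fin N) (f : SmoothFun N) : val (pdLinear q f) = pd q (val f) :=
  rfl

theorem pdLinear_mul (q : Fin N) (f g : SmoothFun N) :
    pdLinear q (f * g) = f * pdLinear q g + g * pdLinear q f := by
  apply val_injective
  ext x
  simp [pd, fderiv_mul (differentiableAt_val f x) (differentiableAt_val g x)]

@[simp]
theorem pdLinear_one (q : Fin N) : pdLinear q (1 : SmoothFun N) = 0 := by
  simpa using pdLinear_mul q 1 1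

/-- A time variable as a smooth function. -/
def coord (q : Fin N) : SmoothFun N :=
  mk (fun x => x q) (contDiff_apply ℝ ℝ q)

@[simp]
theorem val_coord (q : Fin N) (x : Fin N → ℝ) : val (coord q) x = x q :=
  rfl

theorem pdLinear_coord (p q : Fin N) : pdLinear p (coord q) = if q = p then 1 else 0 := by
  apply val_injective
  ext x
  have h : fderiv ℝ (fun x : Fin N → ℝ => x q) x = ContinuousLinearMap.proj q :=
    (ContinuousLinearMap.proj (R := ℝ) (φ := fun _ : Fin N => ℝ) q).fderiv
  simp only [val_pdLinear, coord, val_mk, pd, h]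
  by_cases hqp : q = p <;> simp [hqp]

theorem val_aeval_coord (q : Fin N) (p : Polynomial ℝ) (x : Fin N → ℝ) :
    val (Polynomial.aeval (coord q) p) x = p.eval (x q) := by
  induction p using Polynomial.induction_on' with
  | add p r hp hr => simpa using congrArg₂ (· + ·) hp hr
  | monomial k c => simp [Polynomial.aeval_monomial]

end SmoothFun

open SmoothFun

/-- Termwise `∂_X`. The variable of the Hahn series is `P⁻¹`. -/
noncomputable def derX [NeZero N] :
    Derivation ℝ (HahnSeries ℤ (SmoothFun N)) (HahnSeries ℤ (SmoothFun N)) :=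
  hahnDerivation (fun _ => pdLinear 0) fun _ _ => pdLinear_mul 0

/-- Termwise `∂_P`. The variable of the Hahn series is `P⁻¹`. -/
noncomputable def derP :
    Derivation ℝ (HahnSeries ℤ (SmoothFun N)) (HahnSeries ℤ (SmoothFun N)) :=
  hahnDerP (SmoothFun N)

theorem coeff_derX [NeZero N] (a : HahnSeries ℤ (SmoothFun N)) (n : ℤ) :
    (derX a).coeff n = pdLinear 0 (a.coeff n) :=
  rfl

theorem coeff_derP (a : HahnSeries ℤ (SmoothFun N)) (n : ℤ) :
    (derP a).coeff n = (-((n - 1 : ℤ) : ℝ)) • a.coeff (n - 1) :=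
  coeff_hahnDerP a n

/-- The coefficient functions of a Laurent series. -/
noncomputable def toCoeffs (a : HahnSeries ℤ (SmoothFun N)) : Coeffs N :=
  fun n => val (a.coeff (-n))

theorem toCoeffs_injective : Function.Injective (toCoeffs (N := N)) := by
  intro a b h
  ext n : 2
  apply val_injective
  simpa [toCoeffs] using congrFun h (-n)

theorem coeff_eq_zero_of_toCoeffs {a : HahnSeries ℤ (SmoothFun N)} {n : ℤ}
    (h : toCoeffs a (-n) = 0) : a.coeff n = 0 := by
  apply val_injective
  simpa [toCoeffs] using h

theorem exists_toCoeffs_eq {A : Coeffs N} (hA : IsLaurent A) :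
    ∃ a : HahnSeries ℤ (SmoothFun N), toCoeffs a = A := by
  obtain ⟨⟨m, hm⟩, hA⟩ := hA
  have hbdd : BddBelow (Function.support fun n : ℤ => SmoothFun.mk (A (-n)) (hA _)) := by
    refine ⟨-m, mem_lowerBounds.mpr fun n hn => ?_⟩
    rw [Function.mem_support] at hn
    by_contra hlt
    exact hn (val_injective (hm (-n) (by omega)))
  refine ⟨HahnSeries.ofSuppBddBelow _ hbdd, ?_⟩
  funext n
  rw [toCoeffs, HahnSeries.coeff_ofSuppBddBelow, val_mk, neg_neg]

theorem toCoeffs_add (a b : HahnSeries ℤ (SmoothFun N)) :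
    toCoeffs (a + b) = toCoeffs a + toCoeffs b := by
  funext n
  simp [toCoeffs]

theorem toCoeffs_sum {ι : Type*} (s : Finset ι) (a : ι → HahnSeries ℤ (SmoothFun N)) :
    toCoeffs (∑ i ∈ s, a i) = ∑ i ∈ s, toCoeffs (a i) :=
  map_sum (⟨⟨toCoeffs, by funext n; simp [toCoeffs]⟩, toCoeffs_add⟩ :
    HahnSeries ℤ (SmoothFun N) →+ Coeffs N) a s

theorem toCoeffs_smul (r : ℝ) (a : HahnSeries ℤ (SmoothFun N)) :
    toCoeffs (r • a) = r • toCoeffs a := by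
  funext n
  simp [toCoeffs]

theorem toCoeffs_one : toCoeffs (1 : HahnSeries ℤ (SmoothFun N)) = one' := by
  funext n
  by_cases h : n = 0 <;> simp [toCoeffs, one', HahnSeries.coeff_one, h]
  rfl

theorem toCoeffs_mul (a b : HahnSeries ℤ (SmoothFun N)) :
    toCoeffs (a * b) = mul (toCoeffs a) (toCoeffs b) := by
  funext n x
  have hsum : (∑' i : ℤ, toCoeffs a i x * toCoeffs b (n - i) x) =
      ∑ i ∈ (Finset.antidiagonal a.isPWO_support b.isPWO_support (-n)).image fun ij => -ij.1,
        toCoeffs a i x * toCoeffs b (n - i) x := by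
    refine tsum_eq_sum fun i hi => ?_
    by_contra hne
    apply hi
    rw [Finset.mem_image]
    refine ⟨(-i, -(n - i)), Finset.mem_antidiagonal.mpr ⟨?_, ?_, by ring⟩, by simp⟩
    · intro h
      exact hne (by simp [toCoeffs, h])
    · intro h
      exact hne (by simp only [toCoeffs, h]; simp)
  rw [mul, hsum, Finset.sum_image, toCoeffs, HahnSeries.coeff_mul]
  · simp only [map_sum, Finset.sum_apply]
    refine Finset.sum_congr rfl fun ij hij => ?_
    rw [Finset.mem_antidiagonal] at hij
    have : -(n - -ij.1) = ij.2 := by have := hij.2.2; omega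
    simp only [toCoeffs, this, neg_neg]
    rfl
  · intro ij hij kl hkl h
    rw [Finset.mem_coe, Finset.mem_antidiagonal] at hij hkl
    have h1 := hij.2.2
    have h2 := hkl.2.2
    simp only at h
    ext <;> omega

theorem toCoeffs_pow (a : HahnSeries ℤ (SmoothFun N)) (k : ℕ) :
    toCoeffs (a ^ k) = powC (toCoeffs a) k := by
  induction k with
  | zero => rw [pow_zero, toCoeffs_one, powC]
  | succ k ih => rw [pow_succ', toCoeffs_mul, ih, powC]

theorem toCoeffs_derX [NeZero N] (a : HahnSeries ℤ (SmoothFun N)) :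
    toCoeffs (derX a) = dX (toCoeffs a) :=
  rfl

theorem toCoeffs_derP (a : HahnSeries ℤ (SmoothFun N)) :
    toCoeffs (derP a) = dP (toCoeffs a) := by
  funext n x
  have h : -n - 1 = -(n + 1) := by ring
  simp only [toCoeffs, coeff_derP, dP, h]
  simp

theorem toCoeffs_bracket [NeZero N] (a b : HahnSeries ℤ (SmoothFun N)) :
    toCoeffs (bracket derP derX a b) = pb (toCoeffs a) (toCoeffs b) := by
  funext n x
  simp only [pb, ← toCoeffs_derX, ← toCoeffs_derP, ← toCoeffs_mul]
  simp [bracket, toCoeffs]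

theorem toCoeffs_units_zpow (u : (HahnSeries ℤ (SmoothFun N))ˣ) (j : ℤ) :
    toCoeffs ((u ^ j : (HahnSeries ℤ (SmoothFun N))ˣ) : HahnSeries ℤ (SmoothFun N)) =
      zpowPair (toCoeffs u) (toCoeffs (u⁻¹ : (HahnSeries ℤ (SmoothFun N))ˣ)) j := by
  rw [zpowPair]
  split_ifs with hj
  · lift j to ℕ using hj
    rw [Int.toNat_natCast, ← toCoeffs_pow, zpow_natCast, Units.val_pow_eq_pow_val]
  · obtain ⟨k, rfl⟩ := Int.exists_eq_neg_ofNat (not_le.mp hj).le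
    rw [neg_neg, Int.toNat_natCast, ← toCoeffs_pow, zpow_neg, zpow_natCast, ← inv_pow,
      Units.val_pow_eq_pow_val]

theorem toCoeffs_substHom (f : ℤ →₀ Polynomial ℝ) (u : (HahnSeries ℤ (SmoothFun N))ˣ)
    (m : HahnSeries ℤ (SmoothFun N)) :
    toCoeffs (substHom u m (AddMonoidAlgebra.ofCoeff f)) =
      substC f (toCoeffs u) (toCoeffs (u⁻¹ : (HahnSeries ℤ (SmoothFun N))ˣ)) (toCoeffs m) := by
  have hf : (AddMonoidAlgebra.ofCoeff f : LaurentPolynomial (Polynomial ℝ)) =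
      ∑ j ∈ f.support, LaurentPolynomial.C (f j) * LaurentPolynomial.T j := by
    simp only [← LaurentPolynomial.single_eq_C_mul_T]
    exact (AddMonoidAlgebra.sum_coeff_single (AddMonoidAlgebra.ofCoeff f)).symm
  funext n x
  simp only [hf, map_sum, substHom_C_mul_T, toCoeffs_sum, substC, Finset.sum_apply]
  refine Finset.sum_congr rfl fun j _ => ?_
  rw [Polynomial.aeval_def, Polynomial.eval₂_eq_sum, Polynomial.sum, Finset.sum_mul,
    toCoeffs_sum, Finset.sum_apply, Finset.sum_apply]
  refine Finset.sum_congr rfl fun k _ => ?_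
  rw [mul_assoc, mul_comm (m ^ k), ← Algebra.smul_def, toCoeffs_smul, toCoeffs_mul,
    toCoeffs_pow, toCoeffs_units_zpow]
  rfl

end LaurentSeries

section Canonical

open SmoothFun

/-- The variable `P` as a unit of the ring of Laurent series. -/
noncomputable def unitP (N : ℕ) : (HahnSeries ℤ (SmoothFun N))ˣ where
  val := HahnSeries.single (-1) 1
  inv := HahnSeries.single 1 1
  val_inv := by simp
  inv_val := by simp

theorem unitP_zpow (k : ℤ) :
    ((unitP N ^ k : (HahnSeries ℤ (SmoothFun N))ˣ) : HahnSeries ℤ (SmoothFun N)) =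
      HahnSeries.single (-k) 1 := by
  induction k using Int.induction_on with
  | zero => simp
  | succ k ih => rw [zpow_add_one, Units.val_mul, ih, unitP]; simp [add_comm]
  | pred k ih =>
    rw [zpow_sub_one, Units.val_mul, ih, unitP, Units.inv_mk]
    simp [add_comm]

theorem aeval_C (t : SmoothFun N) (p : Polynomial ℝ) :
    Polynomial.aeval (HahnSeries.C t : HahnSeries ℤ (SmoothFun N)) p =
      HahnSeries.C (Polynomial.aeval t p) := by
  rw [Polynomial.aeval_def, Polynomial.aeval_def, Polynomial.hom_eval₂]
  rfl

theorem toCoeffs_substHom_unitP [NeZero N] (F : LaurentPolynomial (Polynomial ℝ)) :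
    toCoeffs (substHom (unitP N) (HahnSeries.C (coord 0)) F) = polyToCoeffs F.coeff := by
  funext n x
  induction F using LaurentPolynomial.induction_on' with
  | add p q hp hq =>
    rw [map_add, toCoeffs_add, Pi.add_apply, Pi.add_apply, hp, hq]
    simp [polyToCoeffs]
  | C_mul_T k p =>
    rw [substHom_C_mul_T, aeval_C, unitP_zpow, toCoeffs, HahnSeries.C_mul_eq_smul,
      ← LaurentPolynomial.single_eq_C_mul_T]
    by_cases h : n = k
    · subst h
      simp [polyToCoeffs, val_aeval_coord, -LaurentPolynomial.single_eq_C_mul_T]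
    · simp [polyToCoeffs, HahnSeries.coeff_single_of_ne (show -n ≠ -k by omega),
        Ne.symm h, -LaurentPolynomial.single_eq_C_mul_T]

theorem substHom_unitP_injective [NeZero N] :
    Function.Injective (substHom (unitP N) (HahnSeries.C (coord 0))) := by
  intro F G h
  have h' := congrArg toCoeffs h
  rw [toCoeffs_substHom_unitP, toCoeffs_substHom_unitP] at h'
  ext n : 1
  exact Polynomial.funext fun r => congrFun (congrFun h' n) fun _ => r

theorem derX_C [NeZero N] (t : SmoothFun N) :
    derX (HahnSeries.C t : HahnSeries ℤ (SmoothFun N)) = HahnSeries.C (pdLinear 0 t) := by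
  ext n : 2
  rw [coeff_derX, HahnSeries.C_apply, HahnSeries.C_apply, HahnSeries.coeff_single,
    HahnSeries.coeff_single]
  split_ifs <;> simp

theorem derP_C (t : SmoothFun N) :
    derP (HahnSeries.C t : HahnSeries ℤ (SmoothFun N)) = 0 := by
  ext n : 2
  rw [coeff_derP, HahnSeries.C_apply, HahnSeries.coeff_single, HahnSeries.coeff_zero]
  split_ifs with h <;> simp [h]

theorem bracket_unitP [NeZero N] :
    bracket derP derX (unitP N : HahnSeries ℤ (SmoothFun N)) (HahnSeries.C (coord 0)) = 1 := by
  rw [bracket_of_eq_zero _ _ _ (derP_C _), derX_C, pdLinear_coord, if_pos rfl, map_one, mul_one]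
  ext n : 2
  rw [coeff_derP, unitP, HahnSeries.coeff_single, HahnSeries.coeff_one]
  by_cases h : n = 0
  · simp [h]
  · simp [h, show n - 1 ≠ -1 by omega]

/-- A canonical pair of Laurent polynomials preserves the bracket of any substituted pair. -/
theorem bracket_substHom_of_canonical [NeZero N] {f g : ℤ →₀ Polynomial ℝ}
    (hfg : pb (polyToCoeffs (N := N) f) (polyToCoeffs g) = one')
    (u : (HahnSeries ℤ (SmoothFun N))ˣ) (m : HahnSeries ℤ (SmoothFun N)) :
    bracket derP derX (substHom u m (AddMonoidAlgebra.ofCoeff f))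
      (substHom u m (AddMonoidAlgebra.ofCoeff g)) = bracket derP derX u.val m := by
  obtain ⟨J, hJ⟩ := exists_bracket_substHom (AddMonoidAlgebra.ofCoeff f)
    (AddMonoidAlgebra.ofCoeff g)
  have hJ1 : J = 1 := by
    apply substHom_unitP_injective (N := N)
    have h := hJ (unitP N) (HahnSeries.C (coord 0)) derP derX
    rw [bracket_unitP, mul_one] at h
    rw [← h, map_one]
    apply toCoeffs_injective
    rw [toCoeffs_bracket, toCoeffs_substHom_unitP, toCoeffs_substHom_unitP, toCoeffs_one]
    exact hfg
  rw [hJ, hJ1, map_one, one_mul]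

end Canonical

section Orlov

open SmoothFun

theorem coeff_inv_eq_zero {R : Type*} [CommRing R] {a b : HahnSeries ℤ R}
    (ha : a.coeff (-1) = 1) (ha' : ∀ n < -1, a.coeff n = 0) (hab : a * b = 1) {n : ℤ}
    (hn : n < 1) : b.coeff n = 0 := by
  rcases subsingleton_or_nontrivial R with _ | _
  · exact Subsingleton.elim _ _
  by_contra hne
  have hord : a.order = -1 := by
    refine le_antisymm (HahnSeries.order_le_of_coeff_ne_zero (by simp [ha])) ?_
    by_contra! h
    refine HahnSeries.leadingCoeff_ne_zero.mpr ?_ (?_ : a.leadingCoeff = 0)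
    · rintro rfl
      simp at ha
    · rw [HahnSeries.leadingCoeff_eq]
      exact ha' _ h
  have hb : b.leadingCoeff ≠ 0 := HahnSeries.leadingCoeff_ne_zero.mpr (by rintro rfl; simp at hne)
  have h := HahnSeries.coeff_mul_order_add_order a b
  rw [hab, HahnSeries.leadingCoeff_eq (x := a), hord, ha, one_mul, HahnSeries.coeff_one,
    if_neg] at h
  · exact hb h.symm
  · have := HahnSeries.order_le_of_coeff_ne_zero hne
    omega

theorem coeff_pow_eq_zero {R : Type*} [CommRing R] {b : HahnSeries ℤ R}
    (hb : ∀ n < 1, b.coeff n = 0) (k : ℕ) {n : ℤ} (hn : n < k) : (b ^ k).coeff n = 0 := by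
  induction k generalizing n with
  | zero => simp [HahnSeries.coeff_one, show n ≠ 0 by simpa using hn.ne]
  | succ k ih =>
    rw [pow_succ]
    refine hahnSeries_coeff_mul_eq_zero fun i j hij => ?_
    by_cases hj : j < 1
    · exact .inr (hb j hj)
    · exact .inl (ih (by push_cast at hn; omega))

/-- The series `∑ s (i + 1) * b ^ (i + 1)` for `b` without terms in degrees less than one. -/
noncomputable def seriesInPowers {R : Type*} [CommRing R] (s : ℕ → R) (b : HahnSeries ℤ R) :
    HahnSeries ℤ R :=
  HahnSeries.ofSuppBddBelow
    (fun n => ∑ i ∈ Finset.range n.toNat, s (i + 1) * (b ^ (i + 1)).coeff n)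
    ⟨0, mem_lowerBounds.mpr fun n hn => by
      by_contra h
      rw [Function.mem_support, Int.toNat_of_nonpos (by omega)] at hn
      simp at hn⟩

theorem coeff_seriesInPowers {R : Type*} [CommRing R] (s : ℕ → R) (b : HahnSeries ℤ R) (n : ℤ) :
    (seriesInPowers s b).coeff n =
      ∑ i ∈ Finset.range n.toNat, s (i + 1) * (b ^ (i + 1)).coeff n :=
  rfl

theorem coeff_seriesInPowers_eq_zero {R : Type*} [CommRing R] (s : ℕ → R) (b : HahnSeries ℤ R)
    {n : ℤ} (hn : n < 1) : (seriesInPowers s b).coeff n = 0 := by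
  rw [coeff_seriesInPowers, Int.toNat_of_nonpos (by omega), Finset.range_zero, Finset.sum_empty]

theorem toCoeffs_seriesInPowers (s : ℕ → SmoothFun N) {b : HahnSeries ℤ (SmoothFun N)}
    (hb : ∀ n < 1, b.coeff n = 0) (n : ℤ) (x : Fin N → ℝ) :
    toCoeffs (seriesInPowers s b) n x =
      ∑' i : ℕ, val (s (i + 1)) x * powC (toCoeffs b) (i + 1) n x := by
  rw [tsum_eq_sum (s := Finset.range (-n).toNat), toCoeffs, coeff_seriesInPowers]
  · simp [← toCoeffs_pow, toCoeffs]
  · intro i hi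
    rw [Finset.mem_range] at hi
    rw [← toCoeffs_pow, toCoeffs, coeff_pow_eq_zero hb _ (by push_cast; omega)]
    simp

/-- The Orlov function as a Laurent series. -/
noncomputable def orlovSeries (s : ℕ → SmoothFun N) (a b : HahnSeries ℤ (SmoothFun N)) :
    HahnSeries ℤ (SmoothFun N) :=
  ∑ q : Fin N, HahnSeries.C ((((q : ℕ) + 1 : ℕ) : ℝ) • coord q) * a ^ (q : ℕ) +
    seriesInPowers s b

theorem toCoeffs_orlovSeries (s : ℕ → SmoothFun N) {a b : HahnSeries ℤ (SmoothFun N)}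
    (hb : ∀ n < 1, b.coeff n = 0) :
    toCoeffs (orlovSeries s a b) = orlov (toCoeffs a) (toCoeffs b) fun i => val (s i) := by
  funext n x
  rw [orlovSeries, toCoeffs_add, toCoeffs_sum, Pi.add_apply, Pi.add_apply,
    toCoeffs_seriesInPowers s hb, orlov, Finset.sum_apply, Finset.sum_apply]
  congr 1
  refine Finset.sum_congr rfl fun q _ => ?_
  rw [HahnSeries.C_mul_eq_smul, ← toCoeffs_pow]
  simp [toCoeffs, coord, mul_assoc]

theorem bracket_orlovSeries [NeZero N] (s : ℕ → SmoothFun N)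
    (a b : HahnSeries ℤ (SmoothFun N)) :
    bracket derP derX a (orlovSeries s a b) =
      derP a + bracket derP derX a (seriesInPowers s b) := by
  rw [orlovSeries, bracket_add_right, bracket_sum_right, Finset.sum_eq_single 0]
  · rw [bracket_mul_pow_self, bracket_of_eq_zero _ _ _ (derP_C _), derX_C, map_smul,
      pdLinear_coord, if_pos rfl]
    simp
  · intro q _ hq
    rw [bracket_mul_pow_self, bracket_of_eq_zero _ _ _ (derP_C _), derX_C, map_smul,
      pdLinear_coord, if_neg hq]
    simp
  · simp

theorem coeff_derP_eq_zero {a : HahnSeries ℤ (SmoothFun N)} {n : ℤ} (h : a.coeff (n - 1) = 0) :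
    (derP a).coeff n = 0 := by
  rw [coeff_derP, h, smul_zero]

theorem coeff_derX_eq_zero [NeZero N] {a : HahnSeries ℤ (SmoothFun N)} {n : ℤ}
    (h : a.coeff n = 0) : (derX a).coeff n = 0 := by
  rw [coeff_derX, h, map_zero]

theorem coeff_bracket_seriesInPowers [NeZero N] (s : ℕ → SmoothFun N)
    {a b : HahnSeries ℤ (SmoothFun N)} (ha : a.coeff (-1) = 1)
    (ha' : ∀ n < -1, a.coeff n = 0) {n : ℤ} (hn : n ≤ 0) :
    (bracket derP derX a (seriesInPowers s b)).coeff n = 0 := by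
  have hX (i : ℤ) (hi : i < 0) : (derX a).coeff i = 0 := by
    rcases (show i < -1 ∨ i = -1 by omega) with h | rfl
    · exact coeff_derX_eq_zero (ha' i h)
    · rw [coeff_derX, ha, pdLinear_one]
  rw [bracket, HahnSeries.coeff_sub, hahnSeries_coeff_mul_eq_zero, hahnSeries_coeff_mul_eq_zero,
    sub_self]
  · intro i j hij
    by_cases hi : i < 0
    · exact .inl (hX i hi)
    · exact .inr (coeff_derP_eq_zero (coeff_seriesInPowers_eq_zero s b (by omega)))
  · intro i j hij
    by_cases hi : i < 0
    · exact .inl (coeff_derP_eq_zero (ha' _ (by omega)))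
    · exact .inr (coeff_derX_eq_zero (coeff_seriesInPowers_eq_zero s b (by omega)))

theorem coeff_bracket_orlovSeries [NeZero N] (s : ℕ → SmoothFun N)
    {a b : HahnSeries ℤ (SmoothFun N)} (ha : a.coeff (-1) = 1)
    (ha' : ∀ n < -1, a.coeff n = 0) {n : ℤ} (hn : n ≤ 0) :
    (bracket derP derX a (orlovSeries s a b)).coeff n =
      (1 : HahnSeries ℤ (SmoothFun N)).coeff n := by
  rw [bracket_orlovSeries, HahnSeries.coeff_add, coeff_bracket_seriesInPowers s ha ha' hn,
    add_zero, HahnSeries.coeff_one]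
  split_ifs with h
  · simp [coeff_derP, h, ha]
  · exact coeff_derP_eq_zero (ha' _ (by omega))

theorem coeff_bracket_eq_zero [NeZero N] {F G : HahnSeries ℤ (SmoothFun N)}
    (hF : ∀ n, 0 ≤ n → F.coeff n = 0) (hG : ∀ n, 1 ≤ n → G.coeff n = 0) {n : ℤ} (hn : 0 < n) :
    (bracket derP derX F G).coeff n = 0 := by
  rw [bracket, HahnSeries.coeff_sub, hahnSeries_coeff_mul_eq_zero, hahnSeries_coeff_mul_eq_zero,
    sub_self]
  · intro i j hij
    by_cases hi : 0 ≤ i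
    · exact .inl (coeff_derX_eq_zero (hF i hi))
    · exact .inr (coeff_derP_eq_zero (hG _ (by omega)))
  · intro i j hij
    by_cases hi : 1 ≤ i
    · exact .inl (coeff_derP_eq_zero (hF _ (by omega)))
    · exact .inr (coeff_derX_eq_zero (hG j (by omega)))

end Orlov

/-- under the twistor data conditions `{f,g} = 1`, `f(μ,M)_{≤0} = 0` and
`g(μ,M)_{≤-1} = 0`, the canonical Poisson relation `{μ,M} = 1` holds. -/
theorem statement18 {N : ℕ} [NeZero N] (mu muinv : Coeffs N)
    (hmu : IsLaurent mu) (hshape : IsDMKPShape mu)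
    (hmuinv : IsLaurent muinv) (hinv : mul mu muinv = one') (hinv' : mul muinv mu = one')
    (S : ℕ → (Fin N → ℝ) → ℝ) (hS : ∀ i : ℕ, ContDiff ℝ (⊤ : ℕ∞) (S i))
    (M : Coeffs N) (hM : M = orlov mu muinv S)
    (f g : ℤ →₀ Polynomial ℝ)
    (hcanon : pb (polyToCoeffs (N := N) f) (polyToCoeffs g) = one')
    (hf : truncLe 0 (substC f mu muinv M) = 0)
    (hg : truncLe (-1) (substC g mu muinv M) = 0) :
    pb mu M = one' := by
  obtain ⟨a, rfl⟩ := exists_toCoeffs_eq hmu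
  obtain ⟨b, rfl⟩ := exists_toCoeffs_eq hmuinv
  have hab : a * b = 1 := toCoeffs_injective (by rw [toCoeffs_mul, toCoeffs_one, hinv])
  have ha : a.coeff (-1) = 1 := SmoothFun.val_injective hshape.1
  have ha' (n : ℤ) (hn : n < -1) : a.coeff n = 0 :=
    coeff_eq_zero_of_toCoeffs (hshape.2 (-n) (by omega))
  let s (i : ℕ) : SmoothFun N := SmoothFun.mk (S i) (hS i)
  let u : (HahnSeries ℤ (SmoothFun N))ˣ := ⟨a, b, hab, by rw [mul_comm, hab]⟩
  obtain rfl : M = toCoeffs (orlovSeries s a b) := by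
    rw [hM, toCoeffs_orlovSeries s fun n => coeff_inv_eq_zero ha ha' hab]
    rfl
  have hF (n : ℤ) (hn : 0 ≤ n) :
      (substHom u (orlovSeries s a b) (AddMonoidAlgebra.ofCoeff f)).coeff n = 0 := by
    apply coeff_eq_zero_of_toCoeffs
    rw [toCoeffs_substHom]
    have h := congrFun hf (-n)
    rwa [truncLe, if_pos (by omega)] at h
  have hG (n : ℤ) (hn : 1 ≤ n) :
      (substHom u (orlovSeries s a b) (AddMonoidAlgebra.ofCoeff g)).coeff n = 0 := by
    apply coeff_eq_zero_of_toCoeffs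
    rw [toCoeffs_substHom]
    have h := congrFun hg (-n)
    rwa [truncLe, if_pos (by omega)] at h
  rw [← toCoeffs_bracket, ← toCoeffs_one]
  congr 1
  ext n : 2
  rcases le_or_gt n 0 with hn | hn
  · exact coeff_bracket_orlovSeries s ha ha' hn
  · rw [HahnSeries.coeff_one, if_neg hn.ne',
      ← coeff_bracket_eq_zero hF hG hn, bracket_substHom_of_canonical hcanon]

end DMKP
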